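/- Let G be a finite simple bipartite graph on n vertices and let i be a nonnegative even integer. For a Sachs subgraph U of G on i vertices, let s(U) and t(U) denote the numbers of components of U that are cycles of length divisible by 4 and cycles of length congruent to 2 mod 4, respectively. Then the coefficients of the characteristic polynomial φ(G,x) = det(xI − A(G)) and the permanental polynomial π(G,x) = per(xI − A(G)) satisfy (−1)^{i/2} a_i = Σ_{U} (−1)^{s(U)} 2^{s(U)+t(U)} and b_i = Σ_{U} 2^{s(U)+t(U)}, where both sums run over all Sachs subgraphs U of G on i vertices, and a_i, b_i are the coefficients of x^{n−i} in φ(G,x) and π(G,x). -/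

import Mathlib

open Polynomial SimpleGraph
open scoped Classical

noncomputable section

/-- The adjacency matrix of a simple graph `G`, with entries in `R`. -/
def adjMat (R : Type*) [Zero R] [One R] {V : Type*} [Fintype V] (G : SimpleGraph V) :
    Matrix V V R := fun u v => if G.Adj u v then 1 else 0

/-- The characteristic polynomial `det (xI - A(G))` of a simple graph `G`. -/
def charPolyG (R : Type*) [CommRing R] {V : Type*} [Fintype V] (G : SimpleGraph V) : R[X] :=
  (adjMat R G).charpoly

/-- The permanental polynomial `per (xI - A(G))` of a simple graph `G`. -/
def permPolyG (R : Type*) [CommRing R] {V : Type*} [Fintype V] (G : SimpleGraph V) : R[X] :=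
  (Matrix.charmatrix (adjMat R G)).permanent

/-- The modified characteristic polynomial `φ_p(G,x) = ∑_{i even} (-1)^{i/2} a_i x^{n-i}`
of a (bipartite) graph `G` on `n` vertices, where `a_i` is the coefficient of `x^{n-i}`
in the characteristic polynomial. -/
def phiP {V : Type*} [Fintype V] (G : SimpleGraph V) : ℝ[X] :=
  ∑ i ∈ Finset.range (Fintype.card V + 1),
    if Even i then
      C ((-1 : ℝ) ^ (i / 2) * (charPolyG ℝ G).coeff (Fintype.card V - i)) *
        X ^ (Fintype.card V - i)
    else 0

/-- `G` contains no cycle whose length is divisible by 4. -/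
def C4kFree {V : Type*} (G : SimpleGraph V) : Prop :=
  ¬ ∃ (v : V) (c : G.Walk v v), c.IsCycle ∧ 4 ∣ c.length

/-- `G` is `4k`-intercyclic: it contains no two vertex-disjoint cycles,
each of length divisible by 4. -/
def Intercyclic4k {V : Type*} (G : SimpleGraph V) : Prop :=
  ¬ ∃ (u v : V) (c : G.Walk u u) (d : G.Walk v v),
      c.IsCycle ∧ d.IsCycle ∧ 4 ∣ c.length ∧ 4 ∣ d.length ∧
      ∀ x, x ∈ c.support → x ∉ d.support

/-- A subgraph `R` of `G` is a cycle of `G` if it is the subgraph traced by some cycle walk. -/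
def IsCycleSubgraph {V : Type*} (G : SimpleGraph V) (R : G.Subgraph) : Prop :=
  ∃ (v : V) (c : G.Walk v v), c.IsCycle ∧ R = c.toSubgraph

/-- The set of all `4k`-cycles (cycles of length divisible by 4) of `G`,
viewed as subgraphs. -/
def cycles4k {V : Type*} (G : SimpleGraph V) : Set G.Subgraph :=
  {R | ∃ (v : V) (c : G.Walk v v), c.IsCycle ∧ 4 ∣ c.length ∧ R = c.toSubgraph}

/-- The connected component `c` of the subgraph `H` is a single edge (a `K₂`). -/
def IsEdgeComp {V : Type*} {G : SimpleGraph V} (H : G.Subgraph)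
    (c : H.coe.ConnectedComponent) : Prop :=
  ∃ x y : H.verts, H.coe.Adj x y ∧ c.supp = {x, y}

/-- The connected component `c` of the subgraph `H` is a cycle: there is a cycle walk whose
support is exactly `c` and which uses every edge of `H` inside `c`. -/
def IsCycleComp {V : Type*} {G : SimpleGraph V} (H : G.Subgraph)
    (c : H.coe.ConnectedComponent) : Prop :=
  ∃ (v : H.verts) (w : H.coe.Walk v v), w.IsCycle ∧
    {x | x ∈ w.support} = c.supp ∧
    ∀ x y : H.verts, H.coe.Adj x y → x ∈ c.supp → w.toSubgraph.Adj x y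

/-- A Sachs subgraph of `G`: a subgraph each of whose connected components is either
a single edge or a cycle. -/
def IsSachs {V : Type*} {G : SimpleGraph V} (H : G.Subgraph) : Prop :=
  ∀ c : H.coe.ConnectedComponent, IsEdgeComp H c ∨ IsCycleComp H c

/-- The number of connected components of the subgraph `H`. -/
def pCount {V : Type*} {G : SimpleGraph V} (H : G.Subgraph) : ℕ :=
  Nat.card H.coe.ConnectedComponent

/-- The number of components of `H` that are cycles of length divisible by 4. -/
def sCount {V : Type*} {G : SimpleGraph V} (H : G.Subgraph) : ℕ :=
  Set.ncard {c : H.coe.ConnectedComponent | IsCycleComp H c ∧ c.supp.ncard % 4 = 0}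

/-- The number of components of `H` that are cycles of length congruent to 2 mod 4. -/
def tCount {V : Type*} {G : SimpleGraph V} (H : G.Subgraph) : ℕ :=
  Set.ncard {c : H.coe.ConnectedComponent | IsCycleComp H c ∧ c.supp.ncard % 4 = 2}

/-- The number of components of `H` that are cycles. -/
def cycCount {V : Type*} {G : SimpleGraph V} (H : G.Subgraph) : ℕ :=
  Set.ncard {c : H.coe.ConnectedComponent | IsCycleComp H c}

/-- `R` is a union of connected components of `H`. -/
def IsComponentUnion {V : Type*} {G : SimpleGraph V} (R H : G.Subgraph) : Prop :=
  R ≤ H ∧ ∀ x y, H.Adj x y → x ∈ R.verts → R.Adj x y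


/-- The permutation `τ` orients the graph `K`: the edges of `K` are exactly the pairs
`{v, τ v}`. -/
def Orients {W : Type*} (K : SimpleGraph W) (τ : Equiv.Perm W) : Prop :=
  ∀ u v, K.Adj u v ↔ τ u = v ∨ τ v = u

namespace Orients

variable {W : Type*} {K : SimpleGraph W} {τ : Equiv.Perm W}

lemma adj_apply (h : Orients K τ) (v : W) : K.Adj v (τ v) := (h _ _).2 (Or.inl rfl)

lemma apply_ne (h : Orients K τ) (v : W) : τ v ≠ v := (h.adj_apply v).ne'

lemma connectedComponentMk_apply (h : Orients K τ) (v : W) :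
    K.connectedComponentMk (τ v) = K.connectedComponentMk v :=
  (ConnectedComponent.sound (h.adj_apply v).reachable).symm

lemma reachable_iff_sameCycle (h : Orients K τ) (u v : W) :
    K.Reachable u v ↔ τ.SameCycle u v := by
  constructor
  · rintro ⟨w⟩
    induction w with
    | nil => exact Equiv.Perm.SameCycle.refl _ _
    | cons hadj _ ih =>
      rcases (h _ _).1 hadj with rfl | rfl
      · exact (Equiv.Perm.sameCycle_apply_left).1 ih
      · exact (Equiv.Perm.sameCycle_apply_left).2 ih
  · have hpow : ∀ (k : ℕ) (x : W), K.Reachable x ((τ ^ k) x) := by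
      intro k
      induction k with
      | zero => intro x; exact Reachable.refl _
      | succ k ih =>
        intro x
        rw [pow_succ, Equiv.Perm.mul_apply]
        exact (h.adj_apply x).reachable.trans (ih _)
    rintro ⟨k, rfl⟩
    obtain ⟨n, rfl | rfl⟩ := k.eq_nat_or_neg
    · simpa using hpow n u
    · have := hpow n ((τ ^ (-(n : ℤ))) u)
      rw [zpow_neg, zpow_natCast] at this ⊢
      simpa using this.symm

lemma exists_walk_pow (h : Orients K τ) (k : ℕ) {u v : W} (huv : (τ ^ k) u = v) :
    ∃ w : K.Walk u v, w.length = k ∧ ∀ j ≤ k, w.getVert j = (τ ^ j) u := by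
  induction k generalizing u with
  | zero =>
    obtain rfl : u = v := by simpa using huv
    exact ⟨Walk.nil, by simp, by simp⟩
  | succ k ih =>
    rw [pow_succ, Equiv.Perm.mul_apply] at huv
    obtain ⟨w, hl, hw⟩ := ih huv
    refine ⟨Walk.cons (h.adj_apply u) w, by simp [hl], ?_⟩
    rintro (_ | j) hj
    · simp
    · rw [Walk.getVert_cons_succ, hw j (by lia), pow_succ, Equiv.Perm.mul_apply]

variable [Fintype W]

lemma coe_support_cycleOf (h : Orients K τ) (v : W) :
    ((τ.cycleOf v).support : Set W) = (K.connectedComponentMk v).supp := by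
  ext x
  rw [Finset.mem_coe, Equiv.Perm.mem_support_cycleOf_iff' (h.apply_ne v),
    ← h.reachable_iff_sameCycle, ConnectedComponent.mem_supp_iff, ConnectedComponent.eq,
    reachable_comm]

lemma card_support_cycleOf (h : Orients K τ) (v : W) :
    (τ.cycleOf v).support.card = (K.connectedComponentMk v).supp.ncard := by
  rw [← h.coe_support_cycleOf, Set.ncard_coe_finset]

lemma mem_cycleOf_support (h : Orients K τ) (v : W) : v ∈ (τ.cycleOf v).support := by
  rw [Equiv.Perm.mem_support_cycleOf_iff' (h.apply_ne v)]

lemma pow_ncard_supp (h : Orients K τ) (v : W) :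
    (τ ^ (K.connectedComponentMk v).supp.ncard) v = v := by
  rw [← h.card_support_cycleOf]
  exact (τ.isCycleOn_support_cycleOf v).pow_card_apply (h.mem_cycleOf_support v)

lemma pow_apply_inj (h : Orients K τ) (v : W) {i j : ℕ}
    (hi : i < (K.connectedComponentMk v).supp.ncard)
    (hj : j < (K.connectedComponentMk v).supp.ncard) (hij : (τ ^ i) v = (τ ^ j) v) : i = j := by
  rw [← h.card_support_cycleOf] at hi hj
  exact Nat.ModEq.eq_of_lt_of_lt
    (((τ.isCycleOn_support_cycleOf v).pow_apply_eq_pow_apply (h.mem_cycleOf_support v)).1 hij) hi hj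

lemma two_le_ncard_supp (h : Orients K τ) (c : K.ConnectedComponent) : 2 ≤ c.supp.ncard := by
  induction c using ConnectedComponent.ind with
  | h v =>
    rw [← h.card_support_cycleOf, Equiv.Perm.two_le_card_support_cycleOf_iff]
    exact h.apply_ne v

lemma sq_apply_ne_iff (h : Orients K τ) (v : W) :
    τ (τ v) ≠ v ↔ (K.connectedComponentMk v).supp.ncard ≠ 2 := by
  have h2 := h.two_le_ncard_supp (K.connectedComponentMk v)
  rw [not_iff_not]
  constructor
  · intro e
    by_contra hne
    have := h.pow_apply_inj v (i := 2) (j := 0) (by lia) (by lia) (by simpa [pow_two] using e)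
    lia
  · intro e
    have := h.pow_ncard_supp v
    rw [e] at this
    simpa [pow_two] using this

/-- A component with more than two vertices is traced by a cycle. -/
lemma exists_isCycle (h : Orients K τ) (v : W)
    (hv : (K.connectedComponentMk v).supp.ncard ≠ 2) :
    ∃ w : K.Walk v v, w.IsCycle ∧ {x | x ∈ w.support} = (K.connectedComponentMk v).supp ∧
      ∀ x y, K.Adj x y → x ∈ (K.connectedComponentMk v).supp → w.toSubgraph.Adj x y := by
  have h2 := h.two_le_ncard_supp (K.connectedComponentMk v)
  obtain ⟨w, hl, hw⟩ := h.exists_walk_pow _ (h.pow_ncard_supp v)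
  set n := (K.connectedComponentMk v).supp.ncard
  have hex : ∀ x, x ∈ (K.connectedComponentMk v).supp → ∃ j < n, (τ ^ j) v = x := by
    intro x hx
    rw [← h.coe_support_cycleOf, Finset.mem_coe] at hx
    obtain ⟨j, hj, hjx⟩ := (τ.isCycleOn_support_cycleOf v).exists_pow_eq (h.mem_cycleOf_support v) hx
    exact ⟨j, by rwa [h.card_support_cycleOf] at hj, hjx⟩
  have hedge : ∀ x, x ∈ (K.connectedComponentMk v).supp → w.toSubgraph.Adj x (τ x) := by
    intro x hx
    obtain ⟨j, hj, rfl⟩ := hex x hx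
    rw [Walk.toSubgraph_adj_iff]
    refine ⟨j, ?_, by lia⟩
    rw [hw j (by lia), hw (j + 1) (by lia), pow_succ', Equiv.Perm.mul_apply]
  refine ⟨w, ?_, ?_, ?_⟩
  · rw [Walk.isCycle_iff_isPath_tail_and_le_length]
    refine ⟨?_, by lia⟩
    rw [← Walk.IsPath.getVert_injOn_iff]
    have htl : w.tail.length + 1 = n := by
      rw [Walk.length_tail_add_one, hl]
      rw [Walk.not_nil_iff_lt_length]
      lia
    intro i hi j hj hij
    simp only [Set.mem_ofPred_eq] at hi hj
    rw [Walk.getVert_tail, Walk.getVert_tail, hw _ (by lia), hw _ (by lia), pow_succ',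
      pow_succ', Equiv.Perm.mul_apply, Equiv.Perm.mul_apply] at hij
    exact h.pow_apply_inj v (by lia) (by lia) (τ.injective hij)
  · ext x
    constructor
    · intro hx
      exact ConnectedComponent.sound ⟨(w.takeUntil x hx).reverse⟩
    · intro hx
      obtain ⟨j, hj, rfl⟩ := hex x hx
      rw [← hw j hj.le]
      exact w.getVert_mem_support j
  · intro x y hxy hx
    rcases (h _ _).1 hxy with rfl | rfl
    · exact hedge x hx
    · refine (hedge y ?_).symm
      rw [ConnectedComponent.mem_supp_iff] at hx ⊢
      rw [← hx, h.connectedComponentMk_apply]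

/-- Component sizes are even when the graph is bipartite. -/
lemma even_ncard_supp (h : Orients K τ) (hK : K.Colorable 2) (c : K.ConnectedComponent) :
    Even c.supp.ncard := by
  induction c using ConnectedComponent.ind with
  | h v =>
    obtain ⟨w, hl, -⟩ := h.exists_walk_pow _ (h.pow_ncard_supp v)
    rw [← hl]
    exact two_colorable_iff_forall_loop_even.1 hK v w

lemma sign_eq_prod [hdec : DecidableEq W] [Fintype K.ConnectedComponent] (h : Orients K τ) :
    Equiv.Perm.sign τ = ∏ c : K.ConnectedComponent, -(-1 : ℤˣ) ^ c.supp.ncard := by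
  obtain rfl : hdec = fun a b => Classical.propDecidable (a = b) := Subsingleton.elim _ _
  rw [Equiv.Perm.sign_of_cycleType', Equiv.Perm.cycleType_def, Multiset.map_map]
  change ∏ f ∈ τ.cycleFactorsFinset, -(-1 : ℤˣ) ^ f.support.card = _
  have hout : ∀ c : K.ConnectedComponent, K.connectedComponentMk c.out = c := fun c => c.out_eq
  symm
  refine Finset.prod_bij (fun c _ => τ.cycleOf c.out) ?_ ?_ ?_ ?_
  · intro c _
    rw [Equiv.Perm.cycleOf_mem_cycleFactorsFinset_iff, Equiv.Perm.mem_support]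
    exact h.apply_ne _
  · intro c _ d _ hcd
    have hs := h.coe_support_cycleOf c.out
    rw [hcd, h.coe_support_cycleOf, hout, hout] at hs
    exact (ConnectedComponent.supp_injective hs).symm
  · intro f hf
    obtain ⟨x, hx⟩ := (Equiv.Perm.mem_cycleFactorsFinset_iff.1 hf).1.nonempty_support
    refine ⟨K.connectedComponentMk x, Finset.mem_univ _, ?_⟩
    rw [Equiv.Perm.cycle_is_cycleOf hx hf]
    exact Equiv.Perm.SameCycle.cycleOf_eq
      ((h.reachable_iff_sameCycle _ _).1 (ConnectedComponent.exact (hout _)))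
  · intro c _
    rw [h.card_support_cycleOf, hout]

end Orients

namespace Orients

variable {W : Type*} {K : SimpleGraph W} {τ τ' : Equiv.Perm W}

lemma connectedComponentMk_inv_apply (h : Orients K τ) (v : W) :
    K.connectedComponentMk (τ⁻¹ v) = K.connectedComponentMk v := by
  simpa using (h.connectedComponentMk_apply (τ⁻¹ v)).symm

/-- Reverse the orientation `τ` on the components in `T`. -/
def flip (h : Orients K τ) (T : Finset K.ConnectedComponent) : Equiv.Perm W where
  toFun v := if K.connectedComponentMk v ∈ T then τ⁻¹ v else τ v
  invFun v := if K.connectedComponentMk v ∈ T then τ v else τ⁻¹ v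
  left_inv v := by
    have := h.connectedComponentMk_inv_apply v
    rw [Equiv.Perm.inv_def] at this
    by_cases hv : K.connectedComponentMk v ∈ T <;> simp [hv, h.connectedComponentMk_apply, this]
  right_inv v := by
    have := h.connectedComponentMk_inv_apply v
    rw [Equiv.Perm.inv_def] at this
    by_cases hv : K.connectedComponentMk v ∈ T <;> simp [hv, h.connectedComponentMk_apply, this]

lemma flip_apply (h : Orients K τ) (T : Finset K.ConnectedComponent) (v : W) :
    h.flip T v = if K.connectedComponentMk v ∈ T then τ⁻¹ v else τ v := rfl

lemma orients_flip (h : Orients K τ) (T : Finset K.ConnectedComponent) :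
    Orients K (h.flip T) := by
  have key : ∀ u v, K.connectedComponentMk u = K.connectedComponentMk v →
      (K.Adj u v ↔ h.flip T u = v ∨ h.flip T v = u) := by
    intro u v huv
    rw [h.flip_apply, h.flip_apply, huv, h u v]
    split_ifs
    · rw [Equiv.Perm.inv_eq_iff_eq, Equiv.Perm.inv_eq_iff_eq, eq_comm, or_comm,
      eq_comm (a := v), eq_comm (a := u)]
    · rfl
  have hmk : ∀ u, K.connectedComponentMk (h.flip T u) = K.connectedComponentMk u := by
    intro u
    rw [h.flip_apply]
    split_ifs
    · exact h.connectedComponentMk_inv_apply u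
    · exact h.connectedComponentMk_apply u
  intro u v
  refine ⟨fun e => (key u v (ConnectedComponent.sound e.reachable)).1 e, fun e => (key u v ?_).2 e⟩
  rcases e with rfl | rfl
  · exact (hmk u).symm
  · exact hmk v

/-- Two orientations either agree or are opposite at each vertex. -/
lemma apply_eq_or (h : Orients K τ) (h' : Orients K τ') (v : W) :
    (τ' v = τ v ∧ τ'⁻¹ v = τ⁻¹ v) ∨ (τ' v = τ⁻¹ v ∧ τ'⁻¹ v = τ v) := by
  have e : ∀ w, (τ v = w ∨ τ⁻¹ v = w) ↔ (τ' v = w ∨ τ'⁻¹ v = w) := by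
    intro w
    rw [Equiv.Perm.inv_eq_iff_eq, Equiv.Perm.inv_eq_iff_eq, eq_comm (a := v), eq_comm (a := v),
      ← h v w, ← h' v w]
  have e1 := (e (τ v)).1 (Or.inl rfl)
  have e2 := (e (τ⁻¹ v)).1 (Or.inr rfl)
  have e3 := (e (τ' v)).2 (Or.inl rfl)
  have e4 := (e (τ'⁻¹ v)).2 (Or.inr rfl)
  grind

lemma apply_eq_of_reachable (h : Orients K τ) (h' : Orients K τ') {u v : W}
    (huv : K.Reachable u v) (hu : τ' u = τ u) : τ' v = τ v := by
  have step : ∀ x, τ' x = τ x → τ'⁻¹ x = τ⁻¹ x := by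
    intro x hx
    rcases h.apply_eq_or h' x with e | e
    · exact e.2
    · rw [e.2, ← hx, e.1]
  obtain ⟨w⟩ := huv
  induction w with
  | nil => exact hu
  | @cons a b _ hadj _ ih =>
    apply ih
    rcases (h _ _).1 hadj with rfl | rfl
    · rcases h.apply_eq_or h' (τ a) with e | e
      · exact e.1
      · have : τ'⁻¹ (τ a) = a := by rw [← hu]; simp
        rw [e.1, ← e.2, this]; simp
    · have : τ'⁻¹ (τ b) = b := by rw [step _ hu]; simp
      exact (Equiv.Perm.inv_eq_iff_eq.1 this).symm

lemma apply_eq_iff_of_reachable (h : Orients K τ) (h' : Orients K τ') {u v : W}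
    (huv : K.Reachable u v) : τ' u = τ u ↔ τ' v = τ v :=
  ⟨h.apply_eq_of_reachable h' huv, h.apply_eq_of_reachable h' huv.symm⟩

variable [Fintype W]

/-- A graph has two orientations for each component with more than two vertices. -/
lemma card_orients [DecidableEq W] [Fintype K.ConnectedComponent] (h : Orients K τ) :
    (Finset.univ.filter (Orients K)).card =
      2 ^ (Finset.univ.filter fun c : K.ConnectedComponent => c.supp.ncard ≠ 2).card := by
  have hout : ∀ c : K.ConnectedComponent, K.connectedComponentMk c.out = c := fun c => c.out_eq
  rw [← Finset.card_powerset]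
  symm
  refine Finset.card_bij (fun T _ => h.flip T) ?_ ?_ ?_
  · intro T _
    simpa using h.orients_flip T
  · have key : ∀ S T : Finset K.ConnectedComponent,
        S ∈ (Finset.univ.filter fun c : K.ConnectedComponent => c.supp.ncard ≠ 2).powerset →
        h.flip S = h.flip T → S ⊆ T := by
      intro S T hS hST c hc
      have hlong : c.supp.ncard ≠ 2 := by
        simpa using Finset.mem_powerset.1 hS hc
      by_contra hcT
      rw [← hout c, ← h.sq_apply_ne_iff] at hlong
      have := congrArg (fun σ : Equiv.Perm W => σ c.out) hST
      simp only [h.flip_apply, hout, hc, hcT, if_true, if_false] at this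
      rw [Equiv.Perm.inv_eq_iff_eq] at this
      exact hlong this.symm
    intro S hS T hT hST
    exact (key S T hS hST).antisymm (key T S hT hST.symm)
  · intro τ' hτ'
    have h' : Orients K τ' := by simpa using hτ'
    refine ⟨Finset.univ.filter fun c => τ' c.out ≠ τ c.out, ?_, ?_⟩
    · rw [Finset.mem_powerset]
      intro c hc
      simp only [Finset.mem_filter, Finset.mem_univ, true_and] at hc ⊢
      rw [← hout c, ← h.sq_apply_ne_iff]
      intro e
      rcases h.apply_eq_or h' c.out with e' | e'
      · exact hc e'.1
      · apply hc
        rw [e'.1, Equiv.Perm.inv_eq_iff_eq, e]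
    · ext v
      rw [h.flip_apply]
      have hr : K.Reachable (K.connectedComponentMk v).out v := ConnectedComponent.exact (hout _)
      simp only [Finset.mem_filter, Finset.mem_univ, true_and, ne_eq,
        h.apply_eq_iff_of_reachable h' hr]
      have := h.apply_eq_or h' v
      split_ifs with hv
      · exact hv.symm
      · exact (this.resolve_left fun e => hv e.1).1.symm

end Orients

/-- Orientations of the individual components glue to an orientation of the graph. -/
lemma exists_orients_of_forall_component {W : Type*} [Finite W] {K : SimpleGraph W}
    (hK : ∀ c : K.ConnectedComponent, ∃ σ : Equiv.Perm W,
      ∀ u v, u ∈ c.supp → (K.Adj u v ↔ σ u = v ∨ σ v = u)) :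
    ∃ τ, Orients K τ := by
  choose σ hσ using hK
  let f : W → W := fun v => σ (K.connectedComponentMk v) v
  have hf : ∀ v, K.Adj v (f v) := fun v => (hσ _ _ _ rfl).2 (Or.inl rfl)
  have hmk : ∀ v, K.connectedComponentMk (f v) = K.connectedComponentMk v := fun v =>
    (ConnectedComponent.sound (hf v).reachable).symm
  have hinj : Function.Injective f := by
    intro u v huv
    have e : K.connectedComponentMk u = K.connectedComponentMk v := by
      rw [← hmk u, huv, hmk v]
    simp only [f, e] at huv
    exact (σ _).injective huv
  refine ⟨Equiv.ofBijective f (Finite.injective_iff_bijective.1 hinj), fun u v => ?_⟩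
  simp only [Equiv.ofBijective_apply]
  constructor
  · intro huv
    have e : K.connectedComponentMk u = K.connectedComponentMk v :=
      ConnectedComponent.sound huv.reachable
    have := (hσ _ _ _ rfl).1 huv
    simp only [f]
    rwa [← e]
  · rintro (rfl | rfl)
    · exact hf u
    · exact (hf v).symm

lemma SimpleGraph.Walk.IsCycle.formPerm_apply_getVert {W : Type*} [DecidableEq W]
    {K : SimpleGraph W} {v : W} {w : K.Walk v v} (hw : w.IsCycle) {i : ℕ} (hi : i < w.length) :
    w.support.tail.formPerm (w.getVert i) = w.getVert (i + 1) := by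
  have hlen : w.support.tail.length = w.length := by simp
  have hget : ∀ k (hk : k < w.support.tail.length),
      w.support.tail[k] = w.getVert (k + 1) := by
    intro k hk
    rw [List.getElem_tail, Walk.support_getElem_eq_getVert]
  rcases i with _ | i
  · have h1 : w.getVert 0 = w.support.tail[w.length - 1]'(by lia) := by
      rw [hget, Nat.sub_add_cancel (by lia), Walk.getVert_length, Walk.getVert_zero]
    rw [h1, List.formPerm_apply_getElem _ hw.support_nodup, hget]
    simp [hlen, Nat.sub_add_cancel (show 1 ≤ w.length by lia)]
  · rw [← hget i (by lia), List.formPerm_apply_getElem _ hw.support_nodup, hget]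
    rw [hlen, Nat.mod_eq_of_lt (by lia)]

section Sachs

variable {V : Type*} {G : SimpleGraph V} {H : G.Subgraph} {c : H.coe.ConnectedComponent}

lemma IsEdgeComp.exists_perm (h : IsEdgeComp H c) : ∃ σ : Equiv.Perm H.verts,
    ∀ u v, u ∈ c.supp → (H.coe.Adj u v ↔ σ u = v ∨ σ v = u) := by
  obtain ⟨x, y, hxy, hc⟩ := h
  refine ⟨Equiv.swap x y, fun u v hu => ?_⟩
  have hne := hxy.ne
  constructor
  · intro huv
    have hv : v ∈ c.supp := by
      rw [ConnectedComponent.mem_supp_iff] at hu ⊢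
      rw [← hu]
      exact ConnectedComponent.sound huv.symm.reachable
    have := huv.ne
    rw [hc] at hu hv
    rcases hu with rfl | rfl <;> rcases hv with rfl | rfl <;> simp_all
  · intro huv
    rw [hc] at hu
    rcases hu with rfl | rfl
    · have : v = y := by
        rcases huv with e | e
        · simpa using e.symm
        · rwa [Equiv.swap_apply_eq_iff, Equiv.swap_apply_left] at e
      rwa [this]
    · have : v = x := by
        rcases huv with e | e
        · simpa using e.symm
        · rwa [Equiv.swap_apply_eq_iff, Equiv.swap_apply_right] at e
      rw [this]
      exact hxy.symm

lemma IsCycleComp.exists_perm (h : IsCycleComp H c) : ∃ σ : Equiv.Perm H.verts,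
    ∀ u v, u ∈ c.supp → (H.coe.Adj u v ↔ σ u = v ∨ σ v = u) := by
  obtain ⟨a, w, hw, hsupp, hadj⟩ := h
  refine ⟨w.support.tail.formPerm, fun u v hu => ?_⟩
  have hpos : 0 < w.length := by have := hw.three_le_length; lia
  have hex : ∀ x, x ∈ w.support → ∃ i < w.length, w.getVert i = x := by
    intro x hx
    obtain ⟨i, rfl, hi⟩ := Walk.mem_support_iff_exists_getVert.1 hx
    rcases hi.lt_or_eq with hi | rfl
    · exact ⟨i, hi, rfl⟩
    · exact ⟨0, hpos, by simp⟩
  have hstep : ∀ x, x ∈ w.support → H.coe.Adj x (w.support.tail.formPerm x) := by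
    intro x hx
    obtain ⟨i, hi, rfl⟩ := hex x hx
    rw [hw.formPerm_apply_getVert hi]
    exact w.adj_getVert_succ hi
  have hu' : u ∈ w.support := by
    have : u ∈ {x | x ∈ w.support} := by rwa [hsupp]
    exact this
  constructor
  · intro huv
    obtain ⟨i, hi, hlt⟩ := w.toSubgraph_adj_iff.1 (hadj u v huv hu)
    rw [← hw.formPerm_apply_getVert hlt, Sym2.eq_iff] at hi
    rcases hi with ⟨rfl, rfl⟩ | ⟨rfl, rfl⟩ <;> simp
  · rintro (rfl | rfl)
    · exact hstep u hu'
    · by_cases hv : v ∈ w.support.tail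
      · exact (hstep v (List.mem_of_mem_tail hv)).symm
      · rw [List.formPerm_apply_of_notMem hv] at hu' ⊢
        have := hstep v hu'
        rw [List.formPerm_apply_of_notMem hv] at this
        exact this

lemma IsCycleComp.three_le_ncard (h : IsCycleComp H c) : 3 ≤ c.supp.ncard := by
  obtain ⟨a, w, hw, hsupp, -⟩ := h
  have hsub : (w.support.tail.toFinset : Set H.verts) = c.supp := by
    rw [← hsupp]
    ext x
    have : a ∈ w.support.tail := w.end_mem_tail_support hw.not_nil
    rw [List.coe_toFinset, Set.mem_ofPred_eq, Set.mem_ofPred_eq, Walk.mem_support_iff]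
    grind
  rw [← hsub, Set.ncard_coe_finset, List.toFinset_card_of_nodup hw.support_nodup]
  simpa using hw.three_le_length

lemma IsSachs.exists_orients [Finite V] (h : IsSachs H) : ∃ τ, Orients H.coe τ :=
  exists_orients_of_forall_component fun c =>
    (h c).elim IsEdgeComp.exists_perm IsCycleComp.exists_perm

variable {τ : Equiv.Perm H.verts}

lemma Orients.isCycleComp_iff [Finite V] (h : Orients H.coe τ) (c : H.coe.ConnectedComponent) :
    IsCycleComp H c ↔ c.supp.ncard ≠ 2 := by
  cases nonempty_fintype H.verts
  refine ⟨fun hc => by have := hc.three_le_ncard; lia, fun hc => ?_⟩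
  induction c using ConnectedComponent.ind with
  | h v => exact ⟨v, h.exists_isCycle v hc⟩

lemma Orients.isSachs [Finite V] (h : Orients H.coe τ) : IsSachs H := by
  cases nonempty_fintype H.verts
  intro c
  rw [h.isCycleComp_iff]
  refine or_iff_not_imp_right.2 fun hc => ?_
  rw [not_not] at hc
  induction c using ConnectedComponent.ind with
  | h v =>
    refine ⟨v, τ v, h.adj_apply v, ?_⟩
    symm
    apply Set.eq_of_subset_of_ncard_le
    · rintro x (rfl | rfl)
      · rfl
      · exact h.connectedComponentMk_apply v
    · rw [hc, Set.ncard_pair (h.apply_ne v).symm]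
    · exact Set.toFinite _

end Sachs

lemma neg_one_pow_half_mul_neg_neg_one_pow {n : ℕ} (hn : Even n) :
    (-1 : ℝ) ^ (n / 2) * -(-1) ^ n = if n % 4 = 0 then -1 else 1 := by
  rw [hn.neg_one_pow]
  split_ifs with h
  · rw [Even.neg_one_pow (by rw [Nat.even_iff]; lia), one_mul]
  · rw [Odd.neg_one_pow (by rw [Nat.even_iff] at hn; rw [Nat.odd_iff]; lia), neg_one_mul, neg_neg]

lemma SimpleGraph.sum_ncard_supp {W : Type*} [Fintype W] (K : SimpleGraph W)
    [Fintype K.ConnectedComponent] : ∑ c : K.ConnectedComponent, c.supp.ncard = Fintype.card W := by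
  rw [← Finset.card_univ, Finset.card_eq_sum_card_fiberwise (f := K.connectedComponentMk)
    (t := Finset.univ) (fun _ _ => Finset.mem_univ _)]
  refine Finset.sum_congr rfl fun c _ => ?_
  rw [← Set.ncard_coe_finset]
  congr 1
  ext x
  simp

section Sachs

variable {V : Type*} [Fintype V] {G : SimpleGraph V} {H : G.Subgraph} {τ : Equiv.Perm H.verts}

lemma Orients.sCount_add_tCount (h : Orients H.coe τ) (hbip : G.Colorable 2) :
    sCount H + tCount H =
      (Finset.univ.filter fun c : H.coe.ConnectedComponent => c.supp.ncard ≠ 2).card := by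
  have heven := h.even_ncard_supp (hbip.of_hom H.hom)
  rw [sCount, tCount, ← Set.ncard_union_eq _ (Set.toFinite _) (Set.toFinite _),
    ← Set.ncard_coe_finset]
  · congr 1
    ext c
    have := heven c
    rw [Nat.even_iff] at this
    simp only [h.isCycleComp_iff, Set.mem_union, Set.mem_ofPred_eq, Finset.coe_filter,
      Finset.mem_univ, true_and]
    lia
  · rw [Set.disjoint_left]
    rintro c ⟨-, h0⟩ ⟨-, h2⟩
    lia

lemma Orients.neg_one_pow_mul_sign (h : Orients H.coe τ) (hbip : G.Colorable 2) :
    (-1 : ℝ) ^ (H.verts.ncard / 2) * ((Equiv.Perm.sign τ : ℤ) : ℝ) = (-1) ^ sCount H := by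
  have heven := h.even_ncard_supp (hbip.of_hom H.hom)
  have hsum : H.verts.ncard / 2 = ∑ c : H.coe.ConnectedComponent, c.supp.ncard / 2 := by
    have : ∑ c : H.coe.ConnectedComponent, c.supp.ncard
        = 2 * ∑ c : H.coe.ConnectedComponent, c.supp.ncard / 2 := by
      rw [Finset.mul_sum]
      exact Finset.sum_congr rfl fun c _ => (Nat.two_mul_div_two_of_even (heven c)).symm
    rw [H.coe.sum_ncard_supp, ← Nat.card_eq_fintype_card, Nat.card_coe_set_eq] at this
    lia
  have hs : sCount H =
      (Finset.univ.filter fun c : H.coe.ConnectedComponent => c.supp.ncard % 4 = 0).card := by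
    rw [sCount, ← Set.ncard_coe_finset]
    congr 1
    ext c
    simp only [h.isCycleComp_iff, Set.mem_ofPred_eq, Finset.coe_filter, Finset.mem_univ, true_and]
    lia
  rw [hsum, hs, ← Finset.prod_pow_eq_pow_sum, h.sign_eq_prod]
  push_cast
  rw [← Finset.prod_mul_distrib, ← Finset.prod_const, Finset.prod_filter]
  exact Finset.prod_congr rfl fun c _ => neg_one_pow_half_mul_neg_neg_one_pow (heven c)

end Sachs

section Expansion

variable {V : Type*} {G : SimpleGraph V}

lemma Orients.ofSubtype_apply_ne_iff {H : G.Subgraph} {τ : Equiv.Perm H.verts}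
    (h : Orients H.coe τ) (v : V) : Equiv.Perm.ofSubtype τ v ≠ v ↔ v ∈ H.verts := by
  by_cases hv : v ∈ H.verts
  · simp only [hv, iff_true]
    rw [Equiv.Perm.ofSubtype_apply_of_mem τ hv]
    exact fun e => h.apply_ne ⟨v, hv⟩ (Subtype.ext e)
  · simp [hv, Equiv.Perm.ofSubtype_apply_of_not_mem τ hv]

lemma Orients.adj_iff_ofSubtype {H : G.Subgraph} {τ : Equiv.Perm H.verts}
    (h : Orients H.coe τ) (u v : V) :
    H.Adj u v ↔ u ≠ v ∧ (Equiv.Perm.ofSubtype τ u = v ∨ Equiv.Perm.ofSubtype τ v = u) := by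
  by_cases hu : u ∈ H.verts
  · by_cases hv : v ∈ H.verts
    · rw [Equiv.Perm.ofSubtype_apply_of_mem τ hu, Equiv.Perm.ofSubtype_apply_of_mem τ hv]
      have := h ⟨u, hu⟩ ⟨v, hv⟩
      rw [Subgraph.coe_adj, Subtype.ext_iff, Subtype.ext_iff] at this
      rw [← this]
      exact ⟨fun e => ⟨e.ne, e⟩, fun e => e.2⟩
    · refine iff_of_false (fun e => hv e.snd_mem) ?_
      rintro ⟨-, e | e⟩
      · rw [Equiv.Perm.ofSubtype_apply_of_mem τ hu] at e
        exact hv (e ▸ (τ ⟨u, hu⟩).2)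
      · rw [Equiv.Perm.ofSubtype_apply_of_not_mem τ hv] at e
        exact hv (e ▸ hu)
  · refine iff_of_false (fun e => hu e.fst_mem) ?_
    rintro ⟨hne, e | e⟩
    · rw [Equiv.Perm.ofSubtype_apply_of_not_mem τ hu] at e
      exact hne e
    · by_cases hv : v ∈ H.verts
      · rw [Equiv.Perm.ofSubtype_apply_of_mem τ hv] at e
        exact hu (e ▸ (τ ⟨v, hv⟩).2)
      · rw [Equiv.Perm.ofSubtype_apply_of_not_mem τ hv] at e
        exact hne e.symm

lemma Orients.subgraph_eq {H H' : G.Subgraph} {τ : Equiv.Perm H.verts}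
    {τ' : Equiv.Perm H'.verts} (h : Orients H.coe τ) (h' : Orients H'.coe τ')
    (e : Equiv.Perm.ofSubtype τ = Equiv.Perm.ofSubtype τ') : H = H' := by
  apply Subgraph.ext
  · ext v
    rw [← h.ofSubtype_apply_ne_iff, ← h'.ofSubtype_apply_ne_iff, e]
  · ext u v
    rw [h.adj_iff_ofSubtype, h'.adj_iff_ofSubtype, e]

variable [Fintype V]

lemma coeff_prod_charmatrix_adjMat (G : SimpleGraph V) (σ : Equiv.Perm V) {i : ℕ} (hi : Even i)
    (hin : i ≤ Fintype.card V) :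
    (∏ v, Matrix.charmatrix (adjMat ℝ G) (σ v) v).coeff (Fintype.card V - i) =
      if σ.support.card = i ∧ ∀ v ∈ σ.support, G.Adj (σ v) v then 1 else 0 := by
  have hprod : ∏ v, Matrix.charmatrix (adjMat ℝ G) (σ v) v =
      C (∏ v ∈ σ.support, -adjMat ℝ G (σ v) v) * X ^ (Fintype.card V - σ.support.card) := by
    rw [← Finset.prod_mul_prod_compl σ.support, map_prod, ← Finset.card_compl,
      ← Finset.prod_const]
    congr 1
    · refine Finset.prod_congr rfl fun v hv => ?_
      rw [Matrix.charmatrix_apply_ne _ _ _ (Equiv.Perm.mem_support.1 hv), map_neg]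
    · refine Finset.prod_congr rfl fun v hv => ?_
      rw [Finset.mem_compl, Equiv.Perm.notMem_support] at hv
      rw [hv, Matrix.charmatrix_apply_eq]
      simp [adjMat]
  have hle : σ.support.card ≤ Fintype.card V := Finset.card_le_univ _
  rw [hprod, coeff_C_mul, coeff_X_pow]
  by_cases hc : σ.support.card = i
  · simp only [hc, if_true, true_and, mul_one]
    split_ifs with hadj
    · rw [Finset.prod_congr rfl (g := fun _ => (-1 : ℝ)) fun v hv => by
        simp [adjMat, hadj v hv]]
      rw [Finset.prod_const, hc, hi.neg_one_pow]
    · push Not at hadj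
      obtain ⟨v, hv, hv'⟩ := hadj
      exact Finset.prod_eq_zero hv (by simp [adjMat, hv'])
  · rw [if_neg (by lia), if_neg (by tauto), mul_zero]

lemma coeff_charPolyG (G : SimpleGraph V) {i : ℕ} (hi : Even i) (hin : i ≤ Fintype.card V) :
    (charPolyG ℝ G).coeff (Fintype.card V - i) =
      ∑ σ : Equiv.Perm V with σ.support.card = i ∧ ∀ v ∈ σ.support, G.Adj (σ v) v,
        ((Equiv.Perm.sign σ : ℤ) : ℝ) := by
  rw [charPolyG, Matrix.charpoly, Matrix.det_apply, finsetSum_coeff, Finset.sum_filter]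
  refine Finset.sum_congr rfl fun σ _ => ?_
  rw [Units.smul_def, coeff_smul, coeff_prod_charmatrix_adjMat G σ hi hin]
  split_ifs <;> simp

lemma coeff_permPolyG (G : SimpleGraph V) {i : ℕ} (hi : Even i) (hin : i ≤ Fintype.card V) :
    (permPolyG ℝ G).coeff (Fintype.card V - i) =
      ∑ σ : Equiv.Perm V with σ.support.card = i ∧ ∀ v ∈ σ.support, G.Adj (σ v) v, (1 : ℝ) := by
  rw [permPolyG, Matrix.permanent, finsetSum_coeff, Finset.sum_filter]
  exact Finset.sum_congr rfl fun σ _ => coeff_prod_charmatrix_adjMat G σ hi hin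

/-- The subgraph spanned by the pairs `{v, σ v}` with `σ v ≠ v`. -/
def permSubgraph (G : SimpleGraph V) (σ : Equiv.Perm V)
    (hσ : ∀ v ∈ σ.support, G.Adj (σ v) v) : G.Subgraph where
  verts := {v | σ v ≠ v}
  Adj u v := u ≠ v ∧ (σ u = v ∨ σ v = u)
  adj_sub := by
    rintro u v ⟨huv, rfl | rfl⟩
    · exact (hσ u (Equiv.Perm.mem_support.2 huv.symm)).symm
    · exact hσ v (Equiv.Perm.mem_support.2 huv)
  edge_vert := by
    rintro u v ⟨huv, rfl | rfl⟩
    · exact huv.symm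
    · exact fun h => huv (σ.injective h)
  symm := ⟨fun u v h => ⟨h.1.symm, h.2.symm⟩⟩

/-- A sum over permutations moving points along edges, grouped by the underlying subgraph. -/
lemma sum_perm_eq_sum_subgraph (G : SimpleGraph V) (i : ℕ) (e : ℤˣ → ℝ) :
    ∑ σ : Equiv.Perm V with σ.support.card = i ∧ ∀ v ∈ σ.support, G.Adj (σ v) v,
        e (Equiv.Perm.sign σ) =
      ∑ H : G.Subgraph with H.verts.ncard = i,
        ∑ τ : Equiv.Perm H.verts with Orients H.coe τ, e (Equiv.Perm.sign τ) := by
  rw [Finset.sum_sigma' _ _ fun H τ => e (Equiv.Perm.sign τ)]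
  symm
  refine Finset.sum_bij (fun p _ => Equiv.Perm.ofSubtype p.2) ?_ ?_ ?_ ?_
  · rintro ⟨H, τ⟩ hp
    simp only [Finset.mem_sigma, Finset.mem_filter, Finset.mem_univ, true_and] at hp ⊢
    obtain ⟨hH, h⟩ := hp
    constructor
    · rw [← hH, ← Set.ncard_coe_finset]
      congr 1
      ext v
      rw [Finset.mem_coe, Equiv.Perm.mem_support, h.ofSubtype_apply_ne_iff]
    · intro v hv
      exact ((h.adj_iff_ofSubtype _ v).2
        ⟨Equiv.Perm.mem_support.1 hv, Or.inr rfl⟩).adj_sub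
  · rintro ⟨H, τ⟩ hp ⟨H', τ'⟩ hp' he
    simp only [Finset.mem_sigma, Finset.mem_filter, Finset.mem_univ, true_and] at hp hp' he
    obtain rfl := hp.2.subgraph_eq hp'.2 he
    rw [Equiv.Perm.ofSubtype_injective he]
  · intro σ hσ
    simp only [Finset.mem_filter, Finset.mem_univ, true_and] at hσ
    have hmem : ∀ v, σ v ∈ (permSubgraph G σ hσ.2).verts ↔ v ∈ (permSubgraph G σ hσ.2).verts :=
      fun v => σ.injective.ne_iff
    refine ⟨⟨permSubgraph G σ hσ.2, σ.subtypePerm hmem⟩, ?_,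
      Equiv.Perm.ofSubtype_subtypePerm hmem fun v hv => hv⟩
    simp only [Finset.mem_sigma, Finset.mem_filter, Finset.mem_univ, true_and]
    constructor
    · refine Eq.trans ?_ ((Set.ncard_coe_finset σ.support).trans hσ.1)
      congr 1
      ext v
      simp [permSubgraph]
    · rintro ⟨u, hu⟩ ⟨v, hv⟩
      rw [Subgraph.coe_adj, Subtype.ext_iff, Subtype.ext_iff]
      refine ⟨fun e => e.2, fun e => ⟨?_, e⟩⟩
      rintro rfl
      exact hu (by simpa using e)
  · rintro ⟨H, τ⟩ _
    rw [Equiv.Perm.sign_ofSubtype]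

/-- A weighted count of the orientations of all subgraphs on `i` vertices, when the weight of
each orientation depends on the subgraph only. -/
lemma sum_subgraph_eq_finsum (hbip : G.Colorable 2) (i : ℕ) (e : ℤˣ → ℝ) (f : G.Subgraph → ℝ)
    (hef : ∀ (H : G.Subgraph) (τ : Equiv.Perm H.verts), H.verts.ncard = i → Orients H.coe τ →
      e (Equiv.Perm.sign τ) = f H) :
    ∑ H : G.Subgraph with H.verts.ncard = i,
        ∑ τ : Equiv.Perm H.verts with Orients H.coe τ, e (Equiv.Perm.sign τ) =
      ∑ᶠ H ∈ {H : G.Subgraph | IsSachs H ∧ H.verts.ncard = i},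
        f H * 2 ^ (sCount H + tCount H) := by
  rw [finsum_mem_eq_toFinset_sum, Set.toFinset_ofPred]
  simp only [and_comm (a := IsSachs _)]
  rw [← Finset.filter_filter, Finset.sum_filter (p := IsSachs)]
  refine Finset.sum_congr rfl fun H hH => ?_
  rw [Finset.mem_filter] at hH
  split_ifs with hs
  · obtain ⟨τ, hτ⟩ := hs.exists_orients
    rw [Finset.sum_congr rfl (g := fun _ => f H) fun τ' hτ' =>
      hef H τ' hH.2 (Finset.mem_filter.1 hτ').2]
    rw [Finset.sum_const, hτ.card_orients, hτ.sCount_add_tCount hbip, nsmul_eq_mul, mul_comm]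
    push_cast
    rfl
  · rw [Finset.filter_eq_empty_iff.2 fun τ _ hτ => hs hτ.isSachs, Finset.sum_empty]

end Expansion

/-- For a bipartite graph `G` on `n` vertices and a nonnegative even `i ≤ n`,
the coefficients of `x^{n-i}` in the characteristic and permanental polynomials satisfy
`(-1)^{i/2} a_i = ∑_U (-1)^{s(U)} 2^{s(U)+t(U)}` and `b_i = ∑_U 2^{s(U)+t(U)}`, summing over
all Sachs subgraphs `U` of `G` on `i` vertices, where `s(U)`, `t(U)` count the cycle
components of `U` of length ≡ 0 mod 4 and ≡ 2 mod 4, respectively. -/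
theorem stmt_5 {V : Type*} [Fintype V] (G : SimpleGraph V) (hbip : G.Colorable 2)
    (i : ℕ) (hi : Even i) (hin : i ≤ Fintype.card V) :
    (-1 : ℝ) ^ (i / 2) * (charPolyG ℝ G).coeff (Fintype.card V - i)
        = ∑ᶠ H ∈ {H : G.Subgraph | IsSachs H ∧ H.verts.ncard = i},
            (-1 : ℝ) ^ sCount H * 2 ^ (sCount H + tCount H)
    ∧ (permPolyG ℝ G).coeff (Fintype.card V - i)
        = ∑ᶠ H ∈ {H : G.Subgraph | IsSachs H ∧ H.verts.ncard = i},
            (2 : ℝ) ^ (sCount H + tCount H) := by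
  constructor
  · rw [coeff_charPolyG G hi hin, sum_perm_eq_sum_subgraph G i fun s => ((s : ℤ) : ℝ)]
    simp only [Finset.mul_sum]
    refine sum_subgraph_eq_finsum hbip i (fun s => (-1) ^ (i / 2) * ((s : ℤ) : ℝ))
      (fun H => (-1) ^ sCount H) fun H τ hH hτ => ?_
    rw [← hH]
    exact hτ.neg_one_pow_mul_sign hbip
  · rw [coeff_permPolyG G hi hin, sum_perm_eq_sum_subgraph G i fun _ => 1,
      sum_subgraph_eq_finsum hbip i (fun _ => 1) (fun _ => 1) fun _ _ _ _ => rfl]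
    simp only [one_mul]

end
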